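/- arXiv:2311.15221 — 2 statements merged into one kernel-verified Lean document; each statement's English description precedes it below -/
import Mathlib

section
/- Let {(Z_i, Y_i)}_{i=1}^n be i.i.d. pairs with Z_i ~ N(0, I_d) and Y_i ~ N(0, 1), with (Z_1, …, Z_n) independent of (Y_1, …, Y_n). There exist absolute constants C, c > 0 such that if C √((log n)/d) ≤ γ ≤ 1, then with probability at least 1 − C e^{−c √d} − C e^{−c log n}, one has min over nonzero δ ∈ R^d with ‖δ‖ ≤ γ of (1/n) Σ_{i=1}^n (Z_i^⊤ δ/‖δ‖)² · (Z_i^⊤ δ + 2 Y_i)(Z_i^⊤ δ + Y_i) ≤ −c (d log n)/n + C. -/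
open MeasureTheory ProbabilityTheory Real

noncomputable section

/-- Euclidean inner product on `Fin d → ℝ`. -/
def dot {d : ℕ} (u v : Fin d → ℝ) : ℝ := ∑ j, u j * v j

/-- Euclidean norm on `Fin d → ℝ`. -/
def nrm {d : ℕ} (u : Fin d → ℝ) : ℝ := Real.sqrt (∑ j, (u j) ^ 2)

/-- Standard Gaussian `N(0, I_d)` on `Fin d → ℝ`. -/
def stdGaussian (d : ℕ) : Measure (Fin d → ℝ) := Measure.pi fun _ => gaussianReal 0 1

/-- Law of `n` i.i.d. draws from `N(0, I_d)`. -/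
def sample (n d : ℕ) : Measure (Fin n → Fin d → ℝ) := Measure.pi fun _ => stdGaussian d

/-- Joint law of i.i.d. pairs `(Z_i, Y_i)` with `Z_i ~ N(0, I_d)`, `Y_i ~ N(0,1)`, and the
`Z`'s independent of the `Y`'s. -/
def samplePairs (n d : ℕ) : Measure ((Fin n → Fin d → ℝ) × (Fin n → ℝ)) :=
  (sample n d).prod (Measure.pi fun _ : Fin n => gaussianReal 0 1)


instance inst_stdGaussian_prob (d : ℕ) : IsProbabilityMeasure (stdGaussian d) := by
  unfold _root_.stdGaussian; infer_instance

instance inst_sample_prob (n d : ℕ) : IsProbabilityMeasure (sample n d) := by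
  unfold sample; infer_instance

instance inst_samplePairs_prob (n d : ℕ) : IsProbabilityMeasure (samplePairs n d) := by
  unfold samplePairs; infer_instance

/-- Lower bound on the Gaussian mass of `[x, x+1]`. -/
lemma gauss_Icc (x : ℝ) (hx : 0 ≤ x) :
    exp (-(x + 1) ^ 2 / 2) / √(2 * π) ≤ (gaussianReal 0 1).real (Set.Icc x (x + 1)) := by
  have h1 : ENNReal.ofReal (exp (-(x + 1) ^ 2 / 2) / √(2 * π)) ≤
      gaussianReal 0 1 (Set.Icc x (x + 1)) := by
    rw [gaussianReal_apply _ (by norm_num)]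
    calc ENNReal.ofReal (exp (-(x + 1) ^ 2 / 2) / √(2 * π))
        = ∫⁻ _ in Set.Icc x (x + 1), ENNReal.ofReal (exp (-(x + 1) ^ 2 / 2) / √(2 * π)) := by
          simp
      _ ≤ _ := by
          apply setLIntegral_mono (by fun_prop)
          intro y hy
          rw [gaussianPDF]
          apply ENNReal.ofReal_le_ofReal
          rw [gaussianPDFReal, div_eq_inv_mul]
          simp only [NNReal.coe_one, mul_one, sub_zero]
          gcongr
          · linarith [hy.1]
          · exact hy.2
  rw [measureReal_def]
  exact (ENNReal.ofReal_le_iff_le_toReal (measure_ne_top _ _)).1 h1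

lemma no_hit (n : ℕ) (x : ℝ) :
    (Measure.pi (fun _ : Fin n => gaussianReal 0 1)).real {y | ∀ i, y i ∉ Set.Icc x (x + 1)} ≤
      exp (-(n * (gaussianReal 0 1).real (Set.Icc x (x + 1)))) := by
  have h : {y : Fin n → ℝ | ∀ i, y i ∉ Set.Icc x (x + 1)} =
      Set.univ.pi (fun _ => (Set.Icc x (x + 1))ᶜ) := by
    ext y; simp
  rw [h, measureReal_def, Measure.pi_pi, ENNReal.toReal_prod]
  simp only [Finset.prod_const, Finset.card_univ, Fintype.card_fin]
  rw [← measureReal_def, probReal_compl_eq_one_sub measurableSet_Icc]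
  set p := (gaussianReal 0 1).real (Set.Icc x (x + 1))
  have hp : p ≤ 1 := measureReal_le_one
  calc (1 - p) ^ n ≤ (exp (-p)) ^ n := by
        apply pow_le_pow_left₀ (by linarith)
        linarith [add_one_le_exp (-p)]
    _ = _ := by rw [← exp_nat_mul]; ring_nf

lemma memLp_pow4 : MemLp (fun x : ℝ => x ^ 4) 2 (gaussianReal 0 1) := by
  have h := (memLp_id_gaussianReal (μ := 0) (v := 1) 8)
  have h2 := h.norm_rpow_div (q := 4)
  have e : ((8 : NNReal) : ENNReal) / 4 = 2 := by
    have h8 : ((8 : NNReal) : ENNReal) = 2 * 4 := by norm_num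
    rw [h8, ENNReal.mul_div_cancel_right (by norm_num) (by norm_num)]
  rw [e] at h2
  refine h2.congr_norm (by fun_prop) ?_
  filter_upwards with y
  have h4 : (4 : ENNReal).toReal = ((4 : ℕ) : ℝ) := by norm_num
  rw [h4, rpow_natCast]
  simp only [id, norm_pow, norm_norm]

lemma sum_pow4 : ∃ K > (0 : ℝ), ∃ V > (0 : ℝ), ∀ m n : ℕ, m ≤ n → 0 < n →
    (Measure.pi (fun _ : Fin m => gaussianReal 0 1)).real {y | K * n < ∑ i, (y i) ^ 4} ≤ V / n := by
  set M := ∫ x, x ^ 4 ∂(gaussianReal 0 1) with hM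
  have hM0 : 0 ≤ M := integral_nonneg fun x => by positivity
  have hV0 := variance_nonneg (fun x : ℝ => x ^ 4) (gaussianReal 0 1)
  refine ⟨M + 1, by linarith, Var[fun x : ℝ => x ^ 4; gaussianReal 0 1] + 1, by linarith, ?_⟩
  intro m n hmn hn
  set V := Var[fun x : ℝ => x ^ 4; gaussianReal 0 1]
  have hn' : (0 : ℝ) < n := by exact_mod_cast hn
  have hmn' : (m : ℝ) ≤ n := by exact_mod_cast hmn
  set P := Measure.pi (fun _ : Fin m => gaussianReal 0 1)
  have hmem : ∀ i : Fin m, MemLp (fun y : Fin m → ℝ => (y i) ^ 4) 2 P := fun i =>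
    memLp_pow4.comp_measurePreserving (measurePreserving_eval (fun _ : Fin m => gaussianReal 0 1) i)
  have hS : MemLp (∑ i, fun y : Fin m → ℝ => (y i) ^ 4) 2 P := by
    apply memLp_finsetSum'
    intro i _; exact hmem i
  have hmean : P[∑ i, fun y : Fin m → ℝ => (y i) ^ 4] = m * M := by
    simp only [Finset.sum_apply]
    rw [integral_finsetSum _ (fun i _ => (hmem i).integrable (by norm_num))]
    have : ∀ i : Fin m, ∫ y, (y i) ^ 4 ∂P = M := fun i =>
      integral_comp_eval (μ := fun _ : Fin m => gaussianReal 0 1) (i := i)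
        (f := fun x : ℝ => x ^ 4) (by fun_prop)
    simp [this]
  have hvar : Var[∑ i, fun y : Fin m → ℝ => (y i) ^ 4; P] = m * V := by
    rw [variance_sum_pi (X := fun _ x => x ^ 4) (fun _ => memLp_pow4)]
    simp [V]
  have hch := meas_ge_le_variance_div_sq hS hn'
  rw [hmean, hvar] at hch
  have hsub : {y : Fin m → ℝ | (M + 1) * n < ∑ i, (y i) ^ 4} ⊆
      {ω | (n : ℝ) ≤ |(∑ i, fun y : Fin m → ℝ => (y i) ^ 4) ω - m * M|} := by
    intro y hy
    simp only [Set.mem_ofPred_eq, Finset.sum_apply] at hy ⊢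
    refine le_trans ?_ (le_abs_self _)
    nlinarith
  rw [measureReal_def]
  refine ENNReal.toReal_le_of_le_ofReal (by positivity) ((measure_mono hsub).trans (hch.trans ?_))
  apply ENNReal.ofReal_le_ofReal
  rw [div_le_div_iff₀ (by positivity) hn']
  nlinarith [mul_le_mul_of_nonneg_right hmn' hV0, mul_pos hn' hn']

lemma chernoff : ∃ ε > (0 : ℝ), ∃ κ > (0 : ℝ), ∀ d : ℕ,
    (stdGaussian d).real {z | ∑ k, (z k) ^ 2 ≤ ε * d} ≤ exp (-κ * d) := by
  set ρ := ∫ x, exp (-x ^ 2) ∂(gaussianReal 0 1) with hρ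
  have hInteg : Integrable (fun x : ℝ => exp (-x ^ 2)) (gaussianReal 0 1) := by
    refine Integrable.of_bound (by fun_prop) 1 ?_
    filter_upwards with x
    rw [norm_of_nonneg (exp_pos _).le]
    exact exp_le_one_iff.2 (by nlinarith [sq_nonneg x])
  have hρ0 : 0 < ρ := integral_exp_pos hInteg
  have hρ1 : ρ < 1 := by
    have h : 0 < ∫ x, (1 - exp (-x ^ 2)) ∂(gaussianReal 0 1) := by
      rw [integral_pos_iff_support_of_nonneg]
      · have : Function.support (fun x : ℝ => 1 - exp (-x ^ 2)) = {0}ᶜ := by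
          ext x
          simp [sub_eq_zero, eq_comm (a := (1 : ℝ))]
        rw [this]
        have : NullSingletonClass (gaussianReal 0 1) := nullSingletonClass_gaussianReal (by norm_num)
        rw [prob_compl_eq_one_sub (measurableSet_singleton _), measure_singleton]
        simp
      · intro x
        simp only [Pi.zero_apply, sub_nonneg]
        exact exp_le_one_iff.2 (by nlinarith [sq_nonneg x])
      · exact (integrable_const _).sub hInteg
    rw [integral_sub (integrable_const _) hInteg] at h
    simp at h
    linarith
  have hl : log ρ < 0 := log_neg hρ0 hρ1
  refine ⟨-log ρ / 2, by linarith, -log ρ / 2, by linarith, fun d => ?_⟩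
  have hI : Integrable (fun z : Fin d → ℝ => exp ((-1) * ∑ k, (z k) ^ 2)) (stdGaussian d) := by
    refine Integrable.of_bound (Measurable.aestronglyMeasurable (by fun_prop)) 1 ?_
    filter_upwards with x
    rw [norm_of_nonneg (exp_pos _).le]
    exact exp_le_one_iff.2 (by nlinarith [Finset.sum_nonneg (fun k (_ : k ∈ Finset.univ) => sq_nonneg (x k))])
  refine (measure_le_le_exp_mul_mgf (μ := stdGaussian d) (t := -1)
    (X := fun z : Fin d → ℝ => ∑ k, (z k) ^ 2) (-log ρ / 2 * d) (by norm_num) hI).trans ?_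
  have hm : mgf (fun z : Fin d → ℝ => ∑ k, (z k) ^ 2) (stdGaussian d) (-1) = ρ ^ d := by
    rw [mgf, _root_.stdGaussian]
    have : ∀ z : Fin d → ℝ, exp ((-1) * ∑ k, (z k) ^ 2) = ∏ k, exp (-(z k) ^ 2) := by
      intro z
      rw [← exp_sum]; simp
    simp_rw [this]
    rw [integral_fintype_prod_eq_prod (f := fun _ x => exp (-x ^ 2))]
    simp [hρ]
  rw [hm]
  apply le_of_eq
  conv_lhs => rw [← exp_log hρ0, ← exp_nat_mul, ← exp_add]
  rw [log_exp]
  ring_nf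

lemma dot_law {d : ℕ} (u : Fin d → ℝ) (hu : ∑ k, (u k) ^ 2 = 1) :
    (stdGaussian d).map (fun z => dot z u) = gaussianReal 0 1 := by
  have hmeas : Measurable (fun z : Fin d → ℝ => dot z u) := by unfold dot; fun_prop
  have : IsProbabilityMeasure ((stdGaussian d).map (fun z => dot z u)) :=
    Measure.isProbabilityMeasure_map hmeas.aemeasurable
  apply Measure.ext_of_charFun
  ext t
  rw [charFun_apply_real, charFun_gaussianReal, integral_map hmeas.aemeasurable (by fun_prop)]
  have : ∀ z : Fin d → ℝ, Complex.exp (t * (dot z u : ℝ) * Complex.I) =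
      ∏ k, Complex.exp (((t * u k : ℝ) : ℂ) * (z k : ℂ) * Complex.I) := by
    intro z
    rw [← Complex.exp_sum, dot]
    push_cast
    rw [Finset.mul_sum, Finset.sum_mul]
    congr 1
    refine Finset.sum_congr rfl fun k _ => by ring
  simp_rw [this]
  rw [_root_.stdGaussian, integral_fintype_prod_eq_prod
    (f := fun k (x : ℝ) => Complex.exp (((t * u k : ℝ) : ℂ) * (x : ℂ) * Complex.I))]
  simp_rw [← charFun_apply_real, charFun_gaussianReal]
  rw [← Complex.exp_sum]
  congr 1
  have hu' : ∑ k, ((u k : ℂ)) ^ 2 = 1 := by exact_mod_cast hu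
  push_cast
  simp only [mul_zero, zero_mul, zero_sub, one_mul, mul_pow]
  rw [Finset.sum_neg_distrib, ← Finset.sum_div, ← Finset.mul_sum, hu', mul_one]

lemma cross_bound {K V : ℝ} (hK : 0 < K) (hV : 0 < V)
    (h : ∀ m n : ℕ, m ≤ n → 0 < n → (Measure.pi (fun _ : Fin m => gaussianReal 0 1)).real
      {y | K * n < ∑ i, (y i) ^ 4} ≤ V / n) (m d : ℕ) (i : Fin (m + 1)) :
    (sample (m + 1) d).real {Z | K * ((m + 1 : ℕ) : ℝ) <
      ∑ j : Fin m, (dot (Z (i.succAbove j)) (Z i) / nrm (Z i)) ^ 4} ≤ V / ((m + 1 : ℕ) : ℝ) := by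
  set n : ℝ := ((m + 1 : ℕ) : ℝ) with hn
  have hn0 : 0 < n := by rw [hn]; positivity
  have hmp := measurePreserving_piFinSuccAbove
    (fun _ : Fin (m + 1) => (_root_.stdGaussian d)) i
  set A : Set ((Fin d → ℝ) × (Fin m → Fin d → ℝ)) :=
    {p | K * n < ∑ j : Fin m, (dot (p.2 j) p.1 / nrm p.1) ^ 4} with hA
  have hAm : MeasurableSet A := by
    apply measurableSet_lt measurable_const
    unfold dot nrm
    fun_prop
  have hpre : {Z : Fin (m + 1) → Fin d → ℝ | K * n <
      ∑ j : Fin m, (dot (Z (i.succAbove j)) (Z i) / nrm (Z i)) ^ 4} =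
      (MeasurableEquiv.piFinSuccAbove (fun _ : Fin (m + 1) => Fin d → ℝ) i) ⁻¹' A := by
    ext Z
    rfl
  rw [hpre, measureReal_def]
  refine ENNReal.toReal_le_of_le_ofReal (by positivity) ?_
  rw [sample, hmp.measure_preimage hAm.nullMeasurableSet, Measure.prod_apply hAm]
  refine le_trans (lintegral_mono (g := fun _ => ENNReal.ofReal (V / n)) ?_) (by simp)
  intro z
  show (Measure.pi fun _ : Fin m => _root_.stdGaussian d) (Prod.mk z ⁻¹' A) ≤ ENNReal.ofReal (V / n)
  rcases eq_or_ne (nrm z) 0 with hz | hz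
  · have : Prod.mk z ⁻¹' A = ∅ := by
      ext w
      simp only [hA, Set.mem_preimage, Set.mem_ofPred_eq, hz, div_zero, Set.mem_empty_iff_false,
        iff_false, not_lt]
      simp only [ne_eq, OfNat.ofNat_ne_zero, not_false_eq_true, zero_pow, Finset.sum_const_zero]
      positivity
    rw [this]; simp
  · set u : Fin d → ℝ := fun k => z k / nrm z with hu
    have hu1 : ∑ k, (u k) ^ 2 = 1 := by
      simp only [hu, div_pow]
      rw [← Finset.sum_div]
      have : nrm z ^ 2 = ∑ k, (z k) ^ 2 := by
        rw [nrm, sq_sqrt (Finset.sum_nonneg fun k _ => sq_nonneg _)]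
      rw [← this]
      field_simp
    have hdot : ∀ w : Fin d → ℝ, dot w z / nrm z = dot w u := by
      intro w
      simp only [dot, hu, Finset.sum_div]
      refine Finset.sum_congr rfl fun k _ => by ring
    have hmu : Measurable (fun w : Fin d → ℝ => dot w u) := by unfold dot; fun_prop
    have hmap : (Measure.pi fun _ : Fin m => _root_.stdGaussian d).map
        (fun w j => dot (w j) u) = Measure.pi (fun _ : Fin m => gaussianReal 0 1) := by
      have hprob : ∀ _ : Fin m, IsProbabilityMeasure
          ((_root_.stdGaussian d).map (fun w : Fin d → ℝ => dot w u)) := fun _ =>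
        Measure.isProbabilityMeasure_map hmu.aemeasurable
      rw [Measure.pi_map_pi (f := fun (_ : Fin m) (w : Fin d → ℝ) => dot w u)
        (fun _ => hmu.aemeasurable)]
      simp only [dot_law u hu1]
    have hset : Prod.mk z ⁻¹' A = (fun (w : Fin m → Fin d → ℝ) j => dot (w j) u) ⁻¹'
        {y : Fin m → ℝ | K * n < ∑ i, (y i) ^ 4} := by
      ext w
      simp only [hA, Set.mem_preimage, Set.mem_ofPred_eq, hdot]
    rw [hset, ← Measure.map_apply (by fun_prop)
      (measurableSet_lt measurable_const (by fun_prop)), hmap]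
    have := h m (m + 1) (by omega) (by omega)
    rw [measureReal_def] at this
    exact (ENNReal.le_ofReal_iff_toReal_le (measure_ne_top _ _) (by positivity)).2 this

lemma term_bound (a y r : ℝ) (hr0 : 0 ≤ r) (hr1 : r ≤ 1) :
    a ^ 2 * ((-r * a + 2 * y) * (-r * a + y)) ≤ 5 * a ^ 4 + 2 * y ^ 4 := by
  have hr2 : r ^ 2 ≤ 1 := by nlinarith
  have h1 : (-r * a + 2 * y) * (-r * a + y) ≤ 5 / 2 * a ^ 2 + 7 / 2 * y ^ 2 := by
    nlinarith [sq_nonneg (r * a + y), mul_le_mul_of_nonneg_right hr2 (sq_nonneg a)]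
  have h2 := mul_le_mul_of_nonneg_left h1 (sq_nonneg a)
  nlinarith [sq_nonneg (a ^ 2 - y ^ 2), sq_nonneg (a ^ 2), sq_nonneg (y ^ 2)]

lemma deterministic {m d : ℕ} {ε K C γ : ℝ} (hε : 0 < ε)
    (hm : 1 ≤ m) (hC : 4 / √ε ≤ C) (hC2 : 7 * K ≤ C)
    (hγ : C * √(log ((m + 1 : ℕ) : ℝ) / d) ≤ γ) (hγ1 : γ ≤ 1) (hd : 0 < d)
    (Z : Fin (m + 1) → Fin d → ℝ) (y : Fin (m + 1) → ℝ) (i : Fin (m + 1))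
    (hy : y i ∈ Set.Icc (√(log ((m + 1 : ℕ) : ℝ)) / 2) (√(log ((m + 1 : ℕ) : ℝ)) / 2 + 1))
    (hS : ¬ ∑ k, (Z i k) ^ 2 ≤ ε * d)
    (ha : ∑ j : Fin m, (dot (Z (i.succAbove j)) (Z i) / nrm (Z i)) ^ 4 ≤ K * ((m + 1 : ℕ) : ℝ))
    (hY : ∑ j, (y j) ^ 4 ≤ K * ((m + 1 : ℕ) : ℝ)) :
    ∃ δ : Fin d → ℝ, δ ≠ 0 ∧ nrm δ ≤ γ ∧
      (1 / ((m + 1 : ℕ) : ℝ)) * ∑ j, (dot (Z j) δ / nrm δ) ^ 2 *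
        ((dot (Z j) δ + 2 * y j) * (dot (Z j) δ + y j)) ≤
      -(ε / 16) * ((d : ℝ) * log ((m + 1 : ℕ) : ℝ)) / ((m + 1 : ℕ) : ℝ) + C := by
  set n : ℝ := ((m + 1 : ℕ) : ℝ) with hn
  have hn2 : (2 : ℝ) ≤ n := by rw [hn]; exact_mod_cast (by omega : 2 ≤ m + 1)
  have hn0 : 0 < n := by linarith
  set L := log n with hL
  have hL0 : 1 / 4 ≤ L := by
    have h1 : log 2 ≤ L := log_le_log (by norm_num) hn2
    linarith [log_two_gt_d9]
  have hsL : 1 / 2 ≤ √L := by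
    apply le_sqrt_of_sq_le; linarith
  have hd' : (0 : ℝ) < d := by exact_mod_cast hd
  have hsd : 0 < √(d : ℝ) := sqrt_pos.2 hd'
  have hsε : 0 < √ε := sqrt_pos.2 hε
  set s := nrm (Z i) with hs
  have hs1 : √ε * √d < s := by
    rw [← sqrt_mul hε.le, hs, nrm]
    exact sqrt_lt_sqrt (by positivity) (not_le.1 hS)
  have hs0 : 0 < s := lt_trans (by positivity) hs1
  have hss : s ^ 2 = ∑ k, (Z i k) ^ 2 := by
    rw [hs, nrm, sq_sqrt (Finset.sum_nonneg fun k _ => sq_nonneg _)]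
  have hy0 : 0 < y i := by linarith [hy.1]
  set r := 3 / 2 * y i / s with hr
  have hr0 : 0 < r := by positivity
  have hrγ : r ≤ γ := by
    refine le_trans ?_ hγ
    rw [sqrt_div' _ hd'.le]
    calc r ≤ (4 * √L) / (√ε * √d) := by
          rw [hr]
          apply div_le_div₀ (by positivity) _ (by positivity) hs1.le
          linarith [hy.2]
      _ = 4 / √ε * (√L / √d) := by field_simp
      _ ≤ _ := by gcongr
  set δ : Fin d → ℝ := fun k => -(r / s) * Z i k with hδ
  have hnδ : nrm δ = r := by
    have : ∑ k, (δ k) ^ 2 = r ^ 2 := by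
      simp only [hδ, mul_pow]
      rw [← Finset.mul_sum, ← hss]
      field_simp
    rw [nrm, this, sqrt_sq hr0.le]
  have hdot : ∀ w, dot w δ = -r * (dot w (Z i) / s) := by
    intro w
    simp only [dot, hδ, Finset.sum_div, Finset.mul_sum]
    refine Finset.sum_congr rfl fun k _ => by ring
  refine ⟨δ, ?_, hnδ.trans_le hrγ, ?_⟩
  · intro h0
    rw [h0] at hnδ
    simp [nrm] at hnδ
    exact hr0.ne hnδ
  have hsq : ∀ w, (dot w δ / nrm δ) ^ 2 = (dot w (Z i) / s) ^ 2 := by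
    intro w
    rw [hdot, hnδ, mul_div_assoc, div_eq_mul_inv _ r]
    field_simp
  simp only [hsq]
  simp only [hdot]
  rw [Fin.sum_univ_succAbove _ i]
  have hself : dot (Z i) (Z i) / s = s := by
    have : dot (Z i) (Z i) = s ^ 2 := by
      rw [hss, dot]; exact Finset.sum_congr rfl fun k _ => by ring
    rw [this]; field_simp
  rw [hself]
  have hrs : r * s = 3 / 2 * y i := by rw [hr]; field_simp
  have hmain : s ^ 2 * ((-r * s + 2 * y i) * (-r * s + y i)) ≤ -(ε / 16) * (d * L) := by
    have e : s ^ 2 * ((-r * s + 2 * y i) * (-r * s + y i)) = -(s ^ 2 * (y i) ^ 2) / 4 := by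
      rw [neg_mul, hrs]; ring
    rw [e]
    have h1 : ε * d ≤ s ^ 2 := by rw [hss]; exact (not_le.1 hS).le
    have h2 : L / 4 ≤ (y i) ^ 2 := by
      have := pow_le_pow_left₀ (by positivity) hy.1 2
      rw [div_pow, sq_sqrt (by linarith)] at this
      linarith
    have := mul_le_mul h1 h2 (by linarith) (by positivity)
    linarith
  have hrest : ∑ j : Fin m, (dot (Z (i.succAbove j)) (Z i) / s) ^ 2 *
      ((-r * (dot (Z (i.succAbove j)) (Z i) / s) + 2 * y (i.succAbove j)) *
        (-r * (dot (Z (i.succAbove j)) (Z i) / s) + y (i.succAbove j))) ≤ 7 * K * n := by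
    refine (Finset.sum_le_sum fun j _ => term_bound _ _ r hr0.le (hrγ.trans hγ1)).trans ?_
    rw [Finset.sum_add_distrib, ← Finset.mul_sum, ← Finset.mul_sum]
    rw [Fin.sum_univ_succAbove _ i] at hY
    have : 0 ≤ (y i) ^ 4 := by positivity
    linarith
  rw [one_div, ← div_eq_inv_mul, div_le_iff₀ hn0, add_mul (_ / n), div_mul_cancel₀ _ hn0.ne']
  nlinarith [mul_le_mul_of_nonneg_right hC2 hn0.le]

/-- Union bound over the first index with `y i` in the window. -/
lemma combine {n d : ℕ} (x q a b : ℝ) (hq : 0 ≤ q) (B : Fin n → Set (Fin n → Fin d → ℝ))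
    (hB : ∀ i, (sample n d).real (B i) ≤ q) (W : Set (Fin n → ℝ))
    (hW : (Measure.pi (fun _ : Fin n => gaussianReal 0 1)).real W ≤ a)
    (hN : (Measure.pi (fun _ : Fin n => gaussianReal 0 1)).real
      {y | ∀ i, y i ∉ Set.Icc x (x + 1)} ≤ b)
    (G : Set ((Fin n → Fin d → ℝ) × (Fin n → ℝ)))
    (hG : ∀ Z y i, y i ∈ Set.Icc x (x + 1) → Z ∉ B i → y ∉ W → (Z, y) ∈ G) :
    1 - (q + a + b) ≤ (samplePairs n d).real G := by
  set P := Measure.pi (fun _ : Fin n => gaussianReal 0 1) with hP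
  set N : Set (Fin n → ℝ) := {y | ∀ i, y i ∉ Set.Icc x (x + 1)} with hNdef
  set F : Fin n → Set (Fin n → ℝ) := fun i =>
    {y | y i ∈ Set.Icc x (x + 1) ∧ ∀ j < i, y j ∉ Set.Icc x (x + 1)} with hF
  have hFm : ∀ i, MeasurableSet (F i) := by
    intro i
    have : F i = (fun y : Fin n → ℝ => y i) ⁻¹' Set.Icc x (x + 1) ∩
        ⋂ j, ⋂ (_ : j < i), (fun y : Fin n → ℝ => y j) ⁻¹' (Set.Icc x (x + 1))ᶜ := by
      ext y; simp [hF]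
    rw [this]
    exact ((measurable_pi_apply i) measurableSet_Icc).inter
      (MeasurableSet.iInter fun j => MeasurableSet.iInter fun _ =>
        (measurable_pi_apply j) measurableSet_Icc.compl)
  have hFd : Pairwise (Function.onFun Disjoint F) := by
    intro i j hij
    rw [Function.onFun, Set.disjoint_left]
    intro y hyi hyj
    rcases lt_or_gt_of_ne hij with h | h
    · exact hyj.2 i h hyi.1
    · exact hyi.2 j h hyj.1
  have hFs : ∑ i, P.real (F i) ≤ 1 := by
    have h1 : P.real (⋃ i, F i) = ∑ i, P.real (F i) := measureReal_iUnion_fintype hFd hFm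
    rw [← h1]; exact measureReal_le_one
  have hcov : (Set.univ : Set ((Fin n → Fin d → ℝ) × (Fin n → ℝ))) ⊆
      G ∪ ((⋃ i, B i ×ˢ F i) ∪ (Set.univ ×ˢ W ∪ Set.univ ×ˢ N)) := by
    rintro ⟨Z, y⟩ -
    by_cases hyN : y ∈ N
    · right; right; right; exact ⟨trivial, hyN⟩
    by_cases hyW : y ∈ W
    · right; right; left; exact ⟨trivial, hyW⟩
    have hex : ∃ i, y i ∈ Set.Icc x (x + 1) := by
      by_contra hcon
      exact hyN fun i hi => hcon ⟨i, hi⟩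
    obtain ⟨i, hi⟩ : ∃ i, y ∈ F i := by
      classical
      have hne : (Finset.univ.filter fun i => y i ∈ Set.Icc x (x + 1)).Nonempty := by
        obtain ⟨i, hi⟩ := hex
        exact ⟨i, Finset.mem_filter.2 ⟨Finset.mem_univ _, hi⟩⟩
      refine ⟨_, (Finset.mem_filter.1 (Finset.min'_mem _ hne)).2, fun j hj hyj => ?_⟩
      exact absurd (Finset.min'_le _ j (Finset.mem_filter.2 ⟨Finset.mem_univ _, hyj⟩)) (not_le.2 hj)
    by_cases hZ : Z ∈ B i
    · right; left; exact Set.mem_iUnion.2 ⟨i, hZ, hi⟩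
    · left; exact hG Z y i hi.1 hZ hyW
  have hprod : ∀ s t, (samplePairs n d).real (s ×ˢ t) = (sample n d).real s * P.real t := by
    intro s t
    simp only [measureReal_def, samplePairs, Measure.prod_prod, ENNReal.toReal_mul, hP]
  have h1 : (1 : ℝ) = (samplePairs n d).real Set.univ := by simp
  have h2 := measureReal_mono (μ := samplePairs n d) hcov
  have h3 := measureReal_union_le (μ := samplePairs n d) G
    ((⋃ i, B i ×ˢ F i) ∪ (Set.univ ×ˢ W ∪ Set.univ ×ˢ N))
  have h4 := measureReal_union_le (μ := samplePairs n d) (⋃ i, B i ×ˢ F i)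
    (Set.univ ×ˢ W ∪ Set.univ ×ˢ N)
  have h5 := measureReal_union_le (μ := samplePairs n d)
    ((Set.univ : Set (Fin n → Fin d → ℝ)) ×ˢ W) (Set.univ ×ˢ N)
  have h6 : (samplePairs n d).real (⋃ i, B i ×ˢ F i) ≤ q := by
    refine (measureReal_iUnion_fintype_le _).trans ?_
    calc ∑ i, (samplePairs n d).real (B i ×ˢ F i) ≤ ∑ i, q * P.real (F i) := by
          refine Finset.sum_le_sum fun i _ => ?_
          rw [hprod]
          exact mul_le_mul_of_nonneg_right (hB i) measureReal_nonneg
      _ = q * ∑ i, P.real (F i) := by rw [Finset.mul_sum]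
      _ ≤ q := by nlinarith
  rw [hprod, hprod] at h5
  simp only [probReal_univ, one_mul] at h5
  linarith

/-- **Lemma B.2**: for i.i.d. pairs `(Z_i, Y_i)` with `Z_i ~ N(0,I_d)`, `Y_i ~ N(0,1)`,
if `C√(log n / d) ≤ γ ≤ 1`, then with probability at least `1 - C e^{-c√d} - C e^{-c log n}`,
`min_{‖δ‖ ≤ γ} (1/n) Σ_i (Z_i^⊤ δ/‖δ‖)² (Z_i^⊤δ + 2Y_i)(Z_i^⊤δ + Y_i)
   ≤ -c (d log n)/n + C`. -/
theorem stmt10 :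
    ∃ C > (0 : ℝ), ∃ c > (0 : ℝ),
      ∀ (n d : ℕ) (γ : ℝ),
        C * Real.sqrt (Real.log n / d) ≤ γ → γ ≤ 1 →
        1 - C * Real.exp (-c * Real.sqrt d) - C * Real.exp (-c * Real.log n) ≤
          (samplePairs n d
            {p | ∃ δ : Fin d → ℝ, δ ≠ 0 ∧ nrm δ ≤ γ ∧
              (1 / n) * ∑ i, (dot (p.1 i) δ / nrm δ) ^ 2 *
                  ((dot (p.1 i) δ + 2 * p.2 i) * (dot (p.1 i) δ + p.2 i)) ≤
                -c * ((d : ℝ) * Real.log n) / n + C}).toReal := by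
  obtain ⟨K, hK, V, hV, h4⟩ := sum_pow4
  obtain ⟨ε, hε, κ, hκ, hch⟩ := chernoff
  set D : ℝ := √(2 * π) * exp 1 with hD
  have hD0 : 0 < D := by positivity
  have hεC : 0 < 4 / √ε := by have := sqrt_pos.2 hε; positivity
  set C : ℝ := 1 + 4 / √ε + 7 * K + 2 * V + D with hC
  have hC1 : 1 ≤ C := by rw [hC]; linarith
  set c : ℝ := min (ε / 16) (min κ (1 / 2)) with hc
  have hc0 : 0 < c := by rw [hc]; positivity
  have hcε : c ≤ ε / 16 := min_le_left _ _
  have hcκ : c ≤ κ := (min_le_right _ _).trans (min_le_left _ _)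
  have hch2 : c ≤ 1 / 2 := (min_le_right _ _).trans (min_le_right _ _)
  refine ⟨C, by linarith, c, hc0, ?_⟩
  intro n d γ hγ hγ1
  rcases Nat.eq_zero_or_pos d with hd | hd
  · subst hd
    refine le_trans ?_ ENNReal.toReal_nonneg
    simp only [Nat.cast_zero, sqrt_zero, mul_zero, exp_zero, mul_one]
    have : 0 ≤ C * exp (-c * log n) := by positivity
    linarith
  rcases Nat.lt_or_ge n 2 with hn | hn
  · refine le_trans ?_ ENNReal.toReal_nonneg
    have hl : log (n : ℝ) = 0 := by interval_cases n <;> simp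
    rw [hl]
    simp only [mul_zero, exp_zero, mul_one]
    have : 0 ≤ C * exp (-c * √d) := by positivity
    linarith
  obtain ⟨m, rfl⟩ : ∃ m, n = m + 1 := ⟨n - 1, by omega⟩
  have hn1 : (1 : ℝ) ≤ ((m + 1 : ℕ) : ℝ) := by exact_mod_cast (by omega : 1 ≤ m + 1)
  have hn0 : (0 : ℝ) < ((m + 1 : ℕ) : ℝ) := by linarith
  set L := log ((m + 1 : ℕ) : ℝ) with hL
  have hL0 : 0 ≤ L := log_nonneg hn1
  have heL : exp L = ((m + 1 : ℕ) : ℝ) := exp_log hn0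
  set x := √L / 2 with hx
  have hx0 : 0 ≤ x := by positivity
  have hd1 : (1 : ℝ) ≤ d := by exact_mod_cast hd
  set B : Fin (m + 1) → Set (Fin (m + 1) → Fin d → ℝ) := fun i =>
    (fun Z => Z i) ⁻¹' {z | ∑ k, (z k) ^ 2 ≤ ε * d} ∪ {Z | K * ((m + 1 : ℕ) : ℝ) <
      ∑ j : Fin m, (dot (Z (i.succAbove j)) (Z i) / nrm (Z i)) ^ 4} with hBdef
  have hB : ∀ i, (sample (m + 1) d).real (B i) ≤ exp (-κ * d) + V / ((m + 1 : ℕ) : ℝ) := by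
    intro i
    refine (measureReal_union_le _ _).trans (add_le_add ?_ (cross_bound hK hV h4 m d i))
    have hmp := measurePreserving_eval (fun _ : Fin (m + 1) => (_root_.stdGaussian d)) i
    have hms : MeasurableSet {z : Fin d → ℝ | ∑ k, (z k) ^ 2 ≤ ε * d} :=
      measurableSet_le (by fun_prop) measurable_const
    have := hmp.measure_preimage hms.nullMeasurableSet
    rw [measureReal_def, sample]
    refine le_trans (le_of_eq ?_) (hch d)
    rw [measureReal_def]
    exact congrArg ENNReal.toReal this
  have hcomb := combine x _ _ _ (by positivity) B hB {y | K * ((m + 1 : ℕ) : ℝ) < ∑ i, (y i) ^ 4}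
    (h4 (m + 1) (m + 1) le_rfl (by omega)) (no_hit (m + 1) x)
    {p | ∃ δ : Fin d → ℝ, δ ≠ 0 ∧ nrm δ ≤ γ ∧
      (1 / ((m + 1 : ℕ) : ℝ)) * ∑ i, (dot (p.1 i) δ / nrm δ) ^ 2 *
        ((dot (p.1 i) δ + 2 * p.2 i) * (dot (p.1 i) δ + p.2 i)) ≤
      -(ε / 16) * ((d : ℝ) * L) / ((m + 1 : ℕ) : ℝ) + C}
    (fun Z y i hyi hZ hy => by
      simp only [hBdef, Set.mem_union, not_or, Set.mem_preimage, Set.mem_ofPred_eq] at hZ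
      have hdet := deterministic (C := C) (K := K) hε (by omega) (by rw [hC]; linarith)
        (by rw [hC]; linarith) hγ hγ1 hd Z y i hyi hZ.1 (not_lt.1 hZ.2) (not_lt.1 hy)
      exact hdet)
  have hnp : exp (-(((m + 1 : ℕ) : ℝ) * (gaussianReal 0 1).real (Set.Icc x (x + 1)))) ≤
      D * exp (-c * L) := by
    set p := (gaussianReal 0 1).real (Set.Icc x (x + 1)) with hp
    have h1 : exp (3 / 4 * L) / D ≤ ((m + 1 : ℕ) : ℝ) * p := by
      have hg := gauss_Icc x hx0
      calc exp (3 / 4 * L) / D = exp L * (exp (-(L / 4 + 1)) / √(2 * π)) := by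
            rw [hD, mul_comm (√(2 * π)), ← div_div, ← exp_sub, ← mul_div_assoc, ← exp_add]
            ring_nf
        _ ≤ exp L * (exp (-(x + 1) ^ 2 / 2) / √(2 * π)) := by
            have hxx : x ^ 2 = L / 4 := by rw [hx, div_pow, sq_sqrt hL0]; norm_num
            gcongr
            nlinarith [sq_nonneg (x - 1)]
        _ ≤ _ := by rw [heL]; gcongr
    have h2 : 0 < exp (3 / 4 * L) / D := by positivity
    calc exp (-(((m + 1 : ℕ) : ℝ) * p)) ≤ exp (-(exp (3 / 4 * L) / D)) := by gcongr
      _ ≤ (exp (3 / 4 * L) / D)⁻¹ := by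
          rw [exp_neg]
          exact inv_anti₀ h2 (by linarith [add_one_le_exp (exp (3 / 4 * L) / D)])
      _ = D * exp (-(3 / 4 * L)) := by rw [exp_neg, inv_div, div_eq_mul_inv]
      _ ≤ _ := by
          gcongr
          nlinarith
  have hVn : V / ((m + 1 : ℕ) : ℝ) ≤ V * exp (-c * L) := by
    rw [← heL, div_eq_mul_inv, ← exp_neg]
    gcongr
    nlinarith
  have hκd : exp (-κ * d) ≤ exp (-c * √d) := by
    have : √(d : ℝ) ≤ d := sqrt_le_self_iff.2 (Or.inr hd1)
    apply exp_le_exp.2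
    nlinarith [mul_le_mul hcκ this (sqrt_nonneg _) hκ.le]
  have hmono : (samplePairs (m + 1) d).real {p | ∃ δ : Fin d → ℝ, δ ≠ 0 ∧ nrm δ ≤ γ ∧
      (1 / ((m + 1 : ℕ) : ℝ)) * ∑ i, (dot (p.1 i) δ / nrm δ) ^ 2 *
        ((dot (p.1 i) δ + 2 * p.2 i) * (dot (p.1 i) δ + p.2 i)) ≤
      -(ε / 16) * ((d : ℝ) * L) / ((m + 1 : ℕ) : ℝ) + C} ≤
      (samplePairs (m + 1) d).real {p | ∃ δ : Fin d → ℝ, δ ≠ 0 ∧ nrm δ ≤ γ ∧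
      (1 / ((m + 1 : ℕ) : ℝ)) * ∑ i, (dot (p.1 i) δ / nrm δ) ^ 2 *
        ((dot (p.1 i) δ + 2 * p.2 i) * (dot (p.1 i) δ + p.2 i)) ≤
      -c * ((d : ℝ) * L) / ((m + 1 : ℕ) : ℝ) + C} := by
    refine measureReal_mono ?_ (measure_ne_top _ _)
    rintro p ⟨δ, h1, h2, h3⟩
    refine ⟨δ, h1, h2, h3.trans ?_⟩
    gcongr
  refine le_trans ?_ (hcomb.trans hmono)
  have hE1 : 0 < exp (-c * √d) := exp_pos _
  have hE2 : 0 < exp (-c * L) := exp_pos _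
  have hA1 : 1 * exp (-c * √d) ≤ C * exp (-c * √d) := by gcongr
  have hA2 : (2 * V + D) * exp (-c * L) ≤ C * exp (-c * L) := by
    gcongr
    rw [hC]; linarith
  linarith
end
end

section
/- There exist absolute constants C, c > 0 such that for any truncation level t > 0 and any N ≥ 2, with probability at least 1 − C e^{C d − c n} − C/n − C (1 + C N³)^d exp(−c n/(N⁸ t²)) over the draw of x_1, …, x_n, one has sup_{u ∈ S^{d−1}} | (1/n) Σ_{i=1}^n (u^⊤ x_i)³ 1_{|u^⊤ x_i| ≤ N} (w*^⊤ x_i) 1_{|w*^⊤ x_i| ≤ t} | ≤ C. -/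
open MeasureTheory ProbabilityTheory Real

noncomputable section

/-- Real-valued indicator of a decidable proposition. -/
def ind (p : Prop) [Decidable p] : ℝ := if p then 1 else 0

lemma sq_exp_lintegral :
    ∫⁻ y, ENNReal.ofReal (Real.exp (y ^ 2 / 4)) ∂(gaussianReal 0 1) ≤ 2 := by
  rw [gaussianReal_of_var_ne_zero _ one_ne_zero,
    lintegral_withDensity_eq_lintegral_mul _ (measurable_gaussianPDF 0 1) (by fun_prop)]
  have h : ∀ y : ℝ, (gaussianPDF 0 1 * fun y => ENNReal.ofReal (Real.exp (y ^ 2 / 4))) y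
      = ENNReal.ofReal ((√(2 * π))⁻¹ * Real.exp (-(1/4) * y ^ 2)) := by
    intro y
    simp only [Pi.mul_apply, gaussianPDF, gaussianPDFReal]
    rw [← ENNReal.ofReal_mul (by positivity), mul_assoc, ← Real.exp_add]
    congr 2
    · simp
    · congr 1
      simp
      ring
  simp_rw [h]
  rw [← ofReal_integral_eq_lintegral_ofReal]
  · rw [integral_const_mul, integral_gaussian]
    rw [show (2 : ENNReal) = ENNReal.ofReal 2 by simp]
    apply ENNReal.ofReal_le_ofReal
    rw [inv_mul_le_iff₀ (by positivity)]
    apply Real.sqrt_le_iff.2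
    constructor
    · positivity
    · rw [mul_pow, Real.sq_sqrt (by positivity)]
      nlinarith [Real.pi_pos]
  · exact (integrable_exp_neg_mul_sq (by norm_num)).const_mul _
  · exact Filter.Eventually.of_forall fun y => by positivity

instance (d : ℕ) : IsProbabilityMeasure (_root_.stdGaussian d) := by
  unfold _root_.stdGaussian; infer_instance

instance (n d : ℕ) : IsProbabilityMeasure (sample n d) := by
  unfold sample; infer_instance

@[fun_prop]
lemma measurable_dot {d : ℕ} (u : Fin d → ℝ) : Measurable (fun x => dot u x) := by
  unfold dot; fun_prop

lemma nrm_sq {d : ℕ} {u : Fin d → ℝ} (hu : nrm u = 1) : ∑ j, (u j) ^ 2 = 1 := by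
  unfold nrm at hu
  exact (Real.sqrt_eq_one).1 hu

lemma map_dot {d : ℕ} {u : Fin d → ℝ} (hu : nrm u = 1) :
    (_root_.stdGaussian d).map (fun x => dot u x) = gaussianReal 0 1 := by
  have : IsProbabilityMeasure ((_root_.stdGaussian d).map (fun x => dot u x)) :=
    Measure.isProbabilityMeasure_map (measurable_dot u).aemeasurable
  apply Measure.ext_of_charFun
  ext s
  rw [charFun_gaussianReal, charFun_apply_real, integral_map (measurable_dot u).aemeasurable
    (by fun_prop)]
  have h : ∀ x : Fin d → ℝ, Complex.exp (s * (dot u x : ℝ) * Complex.I)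
      = ∏ j, Complex.exp ((s * u j : ℝ) * (x j) * Complex.I) := by
    intro x
    rw [← Complex.exp_sum]
    congr 1
    simp only [dot]
    push_cast
    rw [Finset.mul_sum, Finset.sum_mul]
    exact Finset.sum_congr rfl fun j _ => by ring
  simp_rw [h]
  unfold _root_.stdGaussian
  rw [integral_fintype_prod_eq_prod
    (f := fun j (y : ℝ) => Complex.exp ((s * u j : ℝ) * y * Complex.I))]
  have h2 : ∀ j, ∫ y : ℝ, Complex.exp ((s * u j : ℝ) * y * Complex.I) ∂(gaussianReal 0 1)
      = Complex.exp (- (s:ℂ) ^ 2 / 2 * ((u j : ℝ) : ℂ) ^ 2) := by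
    intro j
    rw [← charFun_apply_real, charFun_gaussianReal]
    congr 1
    push_cast
    ring
  simp_rw [h2]
  rw [← Complex.exp_sum, ← Finset.mul_sum]
  have h3 : ∑ j, ((u j : ℝ) : ℂ) ^ 2 = 1 := by
    exact_mod_cast congrArg (fun r : ℝ => (r : ℂ)) (nrm_sq hu)
  rw [h3]
  congr 1
  push_cast
  ring

lemma dot_exp_lintegral {d : ℕ} {u : Fin d → ℝ} (hu : nrm u = 1) :
    ∫⁻ x, ENNReal.ofReal (Real.exp ((dot u x) ^ 2 / 4)) ∂(_root_.stdGaussian d) ≤ 2 := by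
  refine le_trans (le_of_eq ?_) sq_exp_lintegral
  rw [← map_dot hu, lintegral_map (by fun_prop) (by fun_prop)]

lemma chernoff_s11 {E : Type*} [MeasurableSpace E] (ν : Measure E) [IsProbabilityMeasure ν]
    (n : ℕ) (Z : E → ℝ) (hZ : Measurable Z) (l M a : ℝ) (hl : 0 < l)
    (h : ∫⁻ x, ENNReal.ofReal (Real.exp (l * Z x)) ∂ν ≤ ENNReal.ofReal (Real.exp (l * M))) :
    (Measure.pi fun _ : Fin n => ν) {x | n * (M + a) ≤ ∑ i, Z (x i)} ≤
      ENNReal.ofReal (Real.exp (-(l * n * a))) := by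
  have hind : iIndepFun (fun (i : Fin n) (x : Fin n → E) => ENNReal.ofReal (Real.exp (l * Z (x i))))
      (Measure.pi fun _ : Fin n => ν) :=
    iIndepFun_pi (X := fun _ y => ENNReal.ofReal (Real.exp (l * Z y)))
      (fun _ => by fun_prop)
  have h1 := lintegral_prod_eq_prod_lintegral_of_indepFun Finset.univ _ hind
    (fun i => by fun_prop)
  have h2 : ∀ i : Fin n, ∫⁻ x : Fin n → E, ENNReal.ofReal (Real.exp (l * Z (x i)))
      ∂(Measure.pi fun _ : Fin n => ν) ≤ ENNReal.ofReal (Real.exp (l * M)) := by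
    intro i
    refine le_trans (le_of_eq ?_) h
    exact (measurePreserving_eval (fun _ : Fin n => ν) i).lintegral_comp
      (f := fun y => ENNReal.ofReal (Real.exp (l * Z y))) (by fun_prop)
  have h3 : ∫⁻ x : Fin n → E, ∏ i, ENNReal.ofReal (Real.exp (l * Z (x i)))
      ∂(Measure.pi fun _ : Fin n => ν) ≤ ENNReal.ofReal (Real.exp (l * M * n)) := by
    rw [h1]
    refine (Finset.prod_le_prod' fun i _ => h2 i).trans (le_of_eq ?_)
    rw [Finset.prod_const, Finset.card_univ, Fintype.card_fin, ← ENNReal.ofReal_pow (by positivity),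
      ← Real.exp_nat_mul]
    congr 2; ring
  have h4 := mul_meas_ge_le_lintegral₀ (μ := Measure.pi fun _ : Fin n => ν)
    (f := fun x : Fin n → E => ∏ i, ENNReal.ofReal (Real.exp (l * Z (x i)))) 
    (Measurable.aemeasurable (by fun_prop))
    (ENNReal.ofReal (Real.exp (l * n * (M + a))))
  have hs : {x : Fin n → E | n * (M + a) ≤ ∑ i, Z (x i)} ⊆
      {x | ENNReal.ofReal (Real.exp (l * n * (M + a))) ≤
        ∏ i, ENNReal.ofReal (Real.exp (l * Z (x i)))} := by
    intro x hx
    simp only [Set.mem_ofPred_eq] at hx ⊢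
    rw [← ENNReal.ofReal_prod_of_nonneg (fun i _ => by positivity), ← Real.exp_sum,
      ← Finset.mul_sum]
    apply ENNReal.ofReal_le_ofReal
    apply Real.exp_le_exp.2
    nlinarith
  refine (measure_mono hs).trans ?_
  have h5 := h4.trans h3
  have e1 : Real.exp (l * M * n) = Real.exp (l * n * (M + a)) * Real.exp (-(l * n * a)) := by
    rw [← Real.exp_add]; congr 1; ring
  rw [e1, ENNReal.ofReal_mul (by positivity)] at h5
  exact (ENNReal.mul_le_mul_iff_right (by simp [Real.exp_pos]) (by simp)).1 h5

lemma exists_net (d : ℕ) (ε : ℝ) (hε : 0 < ε) :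
    ∃ T : Finset (EuclideanSpace ℝ (Fin d)), (∀ v ∈ T, ‖v‖ = 1) ∧
      (∀ u, ‖u‖ = 1 → ∃ v ∈ T, ‖u - v‖ ≤ ε) ∧ (T.card : ℝ) ≤ (1 + 2 / ε) ^ d := by
  set e : NNReal := ⟨ε, hε.le⟩
  set A : Set (EuclideanSpace ℝ (Fin d)) := Metric.sphere 0 1
  have hcard : ∀ s : Finset (EuclideanSpace ℝ (Fin d)), (s : Set _) ⊆ A →
      Metric.IsSeparated e (s : Set (EuclideanSpace ℝ (Fin d))) →
      (s.card : ℝ) ≤ (1 + 2 / ε) ^ d := by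
    intro s hsA hsep
    let μ : Measure (EuclideanSpace ℝ (Fin d)) := Measure.addHaar
    have δpos : 0 < ε / 2 := by positivity
    have ρpos : 0 < 1 + ε / 2 := by positivity
    have D : Set.Pairwise (s : Set (EuclideanSpace ℝ (Fin d)))
        (Function.onFun Disjoint fun c => Metric.ball c (ε / 2)) := by
      rintro c hc d hd hcd
      apply Metric.ball_disjoint_ball
      have : (e : ENNReal) < edist c d := hsep hc hd hcd
      rw [edist_dist] at this
      have h2 : ENNReal.ofReal ε < ENNReal.ofReal (dist c d) := by
        convert this
        simp [e, ENNReal.ofReal, Real.toNNReal_of_nonneg hε.le]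
        rfl
      have := (ENNReal.ofReal_lt_ofReal_iff_of_nonneg hε.le).1 h2
      linarith
    have I : (s.card : ENNReal) * ENNReal.ofReal ((ε / 2) ^ d) * μ (Metric.ball 0 1) ≤
        ENNReal.ofReal ((1 + ε / 2) ^ d) * μ (Metric.ball 0 1) :=
      calc
        (s.card : ENNReal) * ENNReal.ofReal ((ε / 2) ^ d) * μ (Metric.ball 0 1)
            = μ (⋃ c ∈ s, Metric.ball c (ε / 2)) := by
          rw [measure_biUnion_finset D fun c _ => measurableSet_ball]
          simp only [μ.addHaar_ball_of_pos _ δpos]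
          simp only [Finset.sum_const, nsmul_eq_mul, mul_assoc, finrank_euclideanSpace_fin]
        _ ≤ μ (Metric.ball 0 (1 + ε / 2)) := by
          apply measure_mono
          refine Set.iUnion₂_subset fun x hx => ?_
          apply Metric.ball_subset_ball'
          have : dist x 0 = 1 := hsA hx
          linarith
        _ = _ := by simp only [μ.addHaar_ball_of_pos _ ρpos, finrank_euclideanSpace_fin]
    have J := (ENNReal.mul_le_mul_iff_left
      (Metric.measure_ball_pos _ _ zero_lt_one).ne' measure_ball_lt_top.ne).1 I
    have K := ENNReal.toReal_le_of_le_ofReal (pow_nonneg ρpos.le _) J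
    rw [ENNReal.toReal_mul, ENNReal.toReal_ofReal (by positivity), ENNReal.toReal_natCast] at K
    have e3 : (1 + 2 / ε) ^ d = (1 + ε / 2) ^ d / (ε / 2) ^ d := by
      rw [← div_pow]; congr 1; field_simp; ring
    rw [e3, le_div_iff₀ (by positivity)]
    exact K
  obtain ⟨K, hK⟩ := exists_nat_ge ((1 + 2 / ε) ^ d)
  have hp : Metric.packingNumber e A ≠ ⊤ := by
    have : Metric.packingNumber e A ≤ (K : ℕ∞) := by
      refine iSup_le fun C => iSup_le fun hC => iSup_le fun hsep => ?_
      by_contra hlt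
      push Not at hlt
      obtain ⟨t, htC, ht⟩ := Set.exists_subset_encard_eq (Order.add_one_le_of_lt hlt)
      have htf : t.Finite := Set.finite_of_encard_eq_coe (k := K + 1) (by rw [ht]; norm_cast)
      lift t to Finset (EuclideanSpace ℝ (Fin d)) using htf
      have h1 := hcard t (htC.trans hC) (hsep.subset htC)
      rw [Set.encard_coe_eq_coe_finsetCard] at ht
      have h2 : t.card = K + 1 := by exact_mod_cast ht
      rw [h2] at h1
      push_cast at h1
      linarith
    exact ne_top_of_le_ne_top (by simp) this
  have hfin : (Metric.maximalSeparatedSet e A).Finite := by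
    rw [← Set.encard_ne_top_iff, Metric.encard_maximalSeparatedSet hp]; exact hp
  refine ⟨hfin.toFinset, ?_, ?_, ?_⟩
  · intro v hv
    have : v ∈ A := Metric.maximalSeparatedSet_subset (hfin.mem_toFinset.1 hv)
    simpa [A] using this
  · intro u hu
    obtain ⟨v, hv, h⟩ := Metric.isCover_maximalSeparatedSet hp (show u ∈ A by simpa [A] using hu)
    refine ⟨v, hfin.mem_toFinset.2 hv, ?_⟩
    rw [← dist_eq_norm]
    simp only [Set.mem_ofPred_eq] at h
    rw [edist_nndist] at h
    exact_mod_cast h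
  · apply hcard
    · simpa using Metric.maximalSeparatedSet_subset
    · simpa using Metric.isSeparated_maximalSeparatedSet

/-- The linear map `u ↦ (u · x_i)_i`. -/
def sampleMap {n d : ℕ} (x : Fin n → Fin d → ℝ) :
    EuclideanSpace ℝ (Fin d) →ₗ[ℝ] EuclideanSpace ℝ (Fin n) where
  toFun u := WithLp.toLp 2 (fun i => dot u.ofLp (x i))
  map_add' u v := by
    ext i
    simp [dot, add_mul, Finset.sum_add_distrib]
  map_smul' r u := by
    ext i
    simp [dot, Finset.mul_sum, mul_assoc]

lemma sampleMap_norm_sq {n d : ℕ} (x : Fin n → Fin d → ℝ) (u : EuclideanSpace ℝ (Fin d)) :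
    ‖sampleMap x u‖ ^ 2 = ∑ i, (dot u.ofLp (x i)) ^ 2 := by
  rw [EuclideanSpace.norm_sq_eq]
  simp [sampleMap]

lemma cov_bound {n d : ℕ} (x : Fin n → Fin d → ℝ) (T : Finset (EuclideanSpace ℝ (Fin d)))
    (hT : ∀ u, ‖u‖ = 1 → ∃ v ∈ T, ‖u - v‖ ≤ 1 / 4)
    (h : ∀ v ∈ T, ∑ i, (dot v.ofLp (x i)) ^ 2 ≤ 8 * n) (u : EuclideanSpace ℝ (Fin d)) :
    ∑ i, (dot u.ofLp (x i)) ^ 2 ≤ 16 * n * ‖u‖ ^ 2 := by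
  set A := (sampleMap x).toContinuousLinearMap with hA
  have hAu : ∀ u, ‖A u‖ ^ 2 = ∑ i, (dot u.ofLp (x i)) ^ 2 := sampleMap_norm_sq x
  have hv : ∀ v ∈ T, ‖A v‖ ≤ √(8 * n) := by
    intro v hv
    apply Real.le_sqrt_of_sq_le
    rw [hAu]; exact h v hv
  have h1 : ‖A‖ ≤ √(8 * n) + ‖A‖ * (1 / 4) := by
    refine ContinuousLinearMap.opNorm_le_of_unit_norm (by positivity) fun w hw => ?_
    obtain ⟨v, hvT, hwv⟩ := hT w hw
    calc ‖A w‖ = ‖A v + A (w - v)‖ := by rw [← map_add]; congr 2; abel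
      _ ≤ ‖A v‖ + ‖A (w - v)‖ := norm_add_le _ _
      _ ≤ √(8 * n) + ‖A‖ * (1 / 4) := by
        refine add_le_add (hv v hvT) ((A.le_opNorm _).trans ?_)
        gcongr
  have h2 : ‖A‖ ^ 2 ≤ 16 * n := by
    have h3 : ‖A‖ ≤ 4 / 3 * √(8 * n) := by linarith
    calc ‖A‖ ^ 2 ≤ (4 / 3 * √(8 * (n : ℝ))) ^ 2 := by gcongr
      _ = 16 / 9 * (8 * (n : ℝ)) := by rw [mul_pow, Real.sq_sqrt (by positivity)]; norm_num
      _ ≤ 16 * (n : ℝ) := by nlinarith [(Nat.cast_nonneg n : (0:ℝ) ≤ n)]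
  rw [← hAu]
  calc ‖A u‖ ^ 2 ≤ (‖A‖ * ‖u‖) ^ 2 := by gcongr; exact A.le_opNorm u
    _ = ‖A‖ ^ 2 * ‖u‖ ^ 2 := by ring
    _ ≤ _ := by gcongr

/-- Lipschitz majorant of the truncated summand. -/
def maj {d : ℕ} (w : Fin d → ℝ) (t N : ℝ) (u x : Fin d → ℝ) : ℝ :=
  (min |dot u x| N) ^ 3 * (|dot w x| * ind (|dot w x| ≤ t))

lemma ind_bounds (a t : ℝ) (ht : 0 < t) :
    0 ≤ |a| * ind (|a| ≤ t) ∧ |a| * ind (|a| ≤ t) ≤ t ∧ |a| * ind (|a| ≤ t) ≤ |a| := by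
  unfold ind
  split_ifs with h
  · simpa using h
  · simpa using ht.le

lemma measurable_maj {d : ℕ} (w : Fin d → ℝ) (t N : ℝ) (u : Fin d → ℝ) :
    Measurable (maj w t N u) := by
  unfold maj ind
  have : Measurable fun x : Fin d → ℝ => if |dot w x| ≤ t then (1:ℝ) else 0 :=
    Measurable.ite (measurableSet_le (by fun_prop) (by fun_prop)) (by fun_prop) (by fun_prop)
  fun_prop

lemma term_le_maj {d : ℕ} (w : Fin d → ℝ) (t N : ℝ) (hN : 0 ≤ N) (ht : 0 < t)
    (u x : Fin d → ℝ) :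
    |(dot u x) ^ 3 * ind (|dot u x| ≤ N) * (dot w x) * ind (|dot w x| ≤ t)| ≤ maj w t N u x := by
  have e : |(dot u x) ^ 3 * ind (|dot u x| ≤ N) * (dot w x) * ind (|dot w x| ≤ t)|
      = (|dot u x| ^ 3 * ind (|dot u x| ≤ N)) * (|dot w x| * ind (|dot w x| ≤ t)) := by
    rw [abs_mul, abs_mul, abs_mul, abs_pow]
    have : ∀ (p : Prop) [Decidable p], |ind p| = ind p := by
      intro p _; unfold ind; split_ifs <;> simp
    rw [this, this]; ring
  rw [e]
  unfold maj
  apply mul_le_mul_of_nonneg_right _ (ind_bounds _ _ ht).1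
  unfold ind
  split_ifs with h
  · rw [min_eq_left h]; simp
  · simp only [mul_zero]; positivity

lemma maj_nonneg {d : ℕ} (w : Fin d → ℝ) (t N : ℝ) (hN : 0 ≤ N) (ht : 0 < t)
    (u x : Fin d → ℝ) : 0 ≤ maj w t N u x := (abs_nonneg _).trans (term_le_maj w t N hN ht u x)

lemma maj_le {d : ℕ} (w : Fin d → ℝ) (t N : ℝ) (hN : 0 ≤ N) (ht : 0 < t)
    (u x : Fin d → ℝ) : maj w t N u x ≤ N ^ 3 * t := by
  unfold maj
  have := ind_bounds (dot w x) t ht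
  apply mul_le_mul _ this.2.1 this.1 (by positivity)
  gcongr
  exact min_le_right _ _

lemma maj_le_exp {d : ℕ} (w : Fin d → ℝ) (t N : ℝ) (hN : 0 ≤ N) (ht : 0 < t)
    (u x : Fin d → ℝ) :
    maj w t N u x ≤ 32 * (Real.exp ((dot u x) ^ 2 / 4) + Real.exp ((dot w x) ^ 2 / 4)) := by
  have hq : ∀ a : ℝ, |a| ^ 4 ≤ 32 * Real.exp (a ^ 2 / 4) := by
    intro a
    have := Real.quadratic_le_exp_of_nonneg (x := a ^ 2 / 4) (by positivity)
    have e : |a| ^ 4 = (a ^ 2) ^ 2 := by rw [← sq_abs a]; ring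
    rw [e]
    nlinarith [sq_nonneg a]
  have h1 : maj w t N u x ≤ |dot u x| ^ 3 * |dot w x| := by
    unfold maj
    have := ind_bounds (dot w x) t ht
    apply mul_le_mul _ this.2.2 this.1 (by positivity)
    gcongr
    exact min_le_left _ _
  have h2 : ∀ a b : ℝ, 0 ≤ a → 0 ≤ b → a ^ 3 * b ≤ a ^ 4 + b ^ 4 := by
    intro a b ha hb
    rcases le_total a b with h | h
    · have : a ^ 3 * b ≤ b ^ 3 * b := by gcongr
      nlinarith [pow_nonneg ha 4]
    · have : a ^ 3 * b ≤ a ^ 3 * a := by gcongr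
      nlinarith [pow_nonneg hb 4]
  linarith [h2 _ _ (abs_nonneg (dot u x)) (abs_nonneg (dot w x)), hq (dot u x), hq (dot w x)]

lemma dot_sub {d : ℕ} (u v x : Fin d → ℝ) : dot (u - v) x = dot u x - dot v x := by
  simp [dot, sub_mul]

lemma maj_lip {d : ℕ} (w : Fin d → ℝ) (t N : ℝ) (hN : 0 ≤ N) (ht : 0 < t)
    (u v x : Fin d → ℝ) :
    maj w t N u x ≤ maj w t N v x +
      3 / 2 * (N ^ 4 * (dot (u - v) x) ^ 2 + (dot w x) ^ 2) := by
  have hI := ind_bounds (dot w x) t ht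
  set q := |dot w x| * ind (|dot w x| ≤ t) with hq
  set p := min |dot u x| N with hp
  set r := min |dot v x| N with hr
  set D := |dot (u - v) x| with hD
  have hp0 : 0 ≤ p := by positivity
  have hr0 : 0 ≤ r := by positivity
  have hpN : p ≤ N := min_le_right _ _
  have hrN : r ≤ N := min_le_right _ _
  have hpr : p - r ≤ D := by
    have h1 : |dot u x| ≤ |dot v x| + D := by
      rw [hD, dot_sub]; have := abs_sub_abs_le_abs_sub (dot u x) (dot v x); linarith
    have h2 : 0 ≤ D := abs_nonneg _
    rw [hp, hr]
    rcases min_cases |dot v x| N with ⟨h, _⟩ | ⟨h, _⟩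
    · rw [h]; linarith [min_le_left |dot u x| N]
    · rw [h]; linarith [min_le_right |dot u x| N]
  have hc : p ^ 3 - r ^ 3 ≤ 3 * N ^ 2 * D := by
    have e : p ^ 3 - r ^ 3 = (p ^ 2 + p * r + r ^ 2) * (p - r) := by ring
    rw [e]
    have h3 : p ^ 2 + p * r + r ^ 2 ≤ 3 * N ^ 2 := by nlinarith
    calc _ ≤ (p ^ 2 + p * r + r ^ 2) * D := by gcongr
      _ ≤ _ := by gcongr
  have hD2 : (dot (u - v) x) ^ 2 = D ^ 2 := (sq_abs _).symm
  have hw2 : (dot w x) ^ 2 = |dot w x| ^ 2 := (sq_abs _).symm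
  have hfin : (p ^ 3 - r ^ 3) * q ≤ 3 * N ^ 2 * D * |dot w x| := by
    calc _ ≤ 3 * N ^ 2 * D * q := mul_le_mul_of_nonneg_right hc hI.1
      _ ≤ _ := by gcongr; exact hI.2.2
  unfold maj
  rw [hD2, hw2]
  nlinarith [sq_nonneg (N ^ 2 * D - |dot w x|)]

lemma maj_exp_lintegral {d : ℕ} {w u : Fin d → ℝ} (hw : nrm w = 1) (hu : nrm u = 1) (t N : ℝ)
    (hN : 0 < N) (ht : 0 < t) :
    ∫⁻ x, ENNReal.ofReal (Real.exp ((N ^ 3 * t)⁻¹ * maj w t N u x)) ∂(_root_.stdGaussian d) ≤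
      ENNReal.ofReal (Real.exp ((N ^ 3 * t)⁻¹ * 256)) := by
  set l := (N ^ 3 * t)⁻¹ with hl
  have hl0 : 0 < l := by positivity
  have hpt : ∀ x, ENNReal.ofReal (Real.exp (l * maj w t N u x)) ≤
      1 + ENNReal.ofReal (64 * l) * (ENNReal.ofReal (Real.exp ((dot u x) ^ 2 / 4)) +
        ENNReal.ofReal (Real.exp ((dot w x) ^ 2 / 4))) := by
    intro x
    rw [← ENNReal.ofReal_add (by positivity) (by positivity),
      ← ENNReal.ofReal_mul (by positivity), ← ENNReal.ofReal_one,
      ← ENNReal.ofReal_add (by positivity) (by positivity)]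
    apply ENNReal.ofReal_le_ofReal
    have h0 := maj_nonneg w t N hN.le ht u x
    have h1 : l * maj w t N u x ≤ 1 := by
      rw [hl, inv_mul_le_iff₀ (by positivity), mul_one]
      exact maj_le w t N hN.le ht u x
    have h2 := maj_le_exp w t N hN.le ht u x
    have hy0 : 0 ≤ l * maj w t N u x := by positivity
    have h3 : Real.exp (l * maj w t N u x) ≤ 1 + 2 * (l * maj w t N u x) := by
      have := Real.abs_exp_sub_one_le (x := l * maj w t N u x) (by rw [abs_of_nonneg hy0]; exact h1)
      rw [abs_of_nonneg hy0] at this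
      linarith [le_abs_self (Real.exp (l * maj w t N u x) - 1)]
    have h4 := mul_le_mul_of_nonneg_left h2 hl0.le
    linarith
  refine (lintegral_mono hpt).trans ?_
  rw [lintegral_add_left (by fun_prop), lintegral_const_mul _ (by fun_prop),
    lintegral_add_left (by fun_prop)]
  simp only [lintegral_const, measure_univ, mul_one]
  calc _ ≤ 1 + ENNReal.ofReal (64 * l) * (2 + 2) := by
        gcongr
        · exact dot_exp_lintegral hu
        · exact dot_exp_lintegral hw
    _ = ENNReal.ofReal (1 + l * 256) := by
        rw [show (2 + 2 : ENNReal) = ENNReal.ofReal 4 by norm_num,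
          ← ENNReal.ofReal_mul (by positivity), ← ENNReal.ofReal_one,
          ← ENNReal.ofReal_add (by positivity) (by positivity)]
        congr 1; ring
    _ ≤ _ := by
        apply ENNReal.ofReal_le_ofReal
        linarith [Real.add_one_le_exp (l * 256)]

lemma nrm_eq {d : ℕ} (u : EuclideanSpace ℝ (Fin d)) : nrm u.ofLp = ‖u‖ := by
  rw [EuclideanSpace.norm_eq]; simp [nrm]

lemma union_tail {Ω E : Type*} [MeasurableSpace Ω] (μ : Measure Ω) (T : Finset E)
    (B : E → Set Ω) (b : ℝ) (K : ℝ) (hK : (T.card : ℝ) ≤ K)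
    (h : ∀ v ∈ T, μ (B v) ≤ ENNReal.ofReal b) :
    μ (⋃ v ∈ T, B v) ≤ ENNReal.ofReal (K * b) := by
  refine (measure_biUnion_finset_le T B).trans ((Finset.sum_le_sum h).trans ?_)
  rw [Finset.sum_const, nsmul_eq_mul, ENNReal.ofReal_mul ((Nat.cast_nonneg _).trans hK)]
  gcongr
  rw [← ENNReal.ofReal_natCast]
  exact ENNReal.ofReal_le_ofReal hK

/-- **Lemma C.1**: there exist absolute constants `C, c > 0` such that for any `t > 0`
and `N ≥ 2`, with probability at least
`1 - C e^{Cd - cn} - C/n - C (1 + C N³)^d e^{-cn/(N⁸ t²)}`,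
`sup_{u ∈ S^{d-1}} |(1/n) Σ_i (u^⊤x_i)³ 1_{|u^⊤x_i| ≤ N} (w*^⊤x_i) 1_{|w*^⊤x_i| ≤ t}| ≤ C`. -/
theorem stmt11 :
    ∃ C > (0 : ℝ), ∃ c > (0 : ℝ),
      ∀ (n d : ℕ) (wstar : Fin d → ℝ) (t N : ℝ),
        nrm wstar = 1 → 0 < t → 2 ≤ N →
        1 - C * Real.exp (C * d - c * n) - C / n -
            C * (1 + C * N ^ 3) ^ d * Real.exp (-c * n / (N ^ 8 * t ^ 2)) ≤
          (sample n d {x | ∀ u : Fin d → ℝ, nrm u = 1 →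
              |(1 / n) * ∑ i, (dot u (x i)) ^ 3 * ind (|dot u (x i)| ≤ N) *
                  (dot wstar (x i)) * ind (|dot wstar (x i)| ≤ t)| ≤ C}).toReal := by
  refine ⟨400, by norm_num, 1, by norm_num, ?_⟩
  intro n d w t N hw ht hN
  set S : Set (Fin n → Fin d → ℝ) := {x | ∀ u : Fin d → ℝ, nrm u = 1 →
              |(1 / n) * ∑ i, (dot u (x i)) ^ 3 * ind (|dot u (x i)| ≤ N) *
                  (dot w (x i)) * ind (|dot w (x i)| ≤ t)| ≤ 400} with hS
  have hN0 : 0 < N := by linarith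
  have hn0 : (0 : ℝ) ≤ n := Nat.cast_nonneg n
  -- reduction to the majorant
  have hred : ∀ x : Fin n → Fin d → ℝ,
      (∀ u : Fin d → ℝ, nrm u = 1 → ∑ i, maj w t N u (x i) ≤ 400 * n) → x ∈ S := by
    intro x hx u hu
    have h1 : |∑ i, (dot u (x i)) ^ 3 * ind (|dot u (x i)| ≤ N) *
        (dot w (x i)) * ind (|dot w (x i)| ≤ t)| ≤ 400 * n :=
      (Finset.abs_sum_le_sum_abs _ _).trans
        ((Finset.sum_le_sum fun i _ => term_le_maj w t N hN0.le ht u (x i)).trans (hx u hu))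
    rw [abs_mul, abs_of_nonneg (by positivity : (0:ℝ) ≤ 1 / n)]
    rcases hn0.eq_or_lt with h | h
    · rw [← h]; simp
    · rw [one_div, inv_mul_le_iff₀ h]; linarith
  have hp1 : 0 ≤ 400 * Real.exp (400 * d - 1 * n) := by positivity
  have hp2 : (0:ℝ) ≤ 400 / n := by positivity
  have hp3 : 0 ≤ 400 * (1 + 400 * N ^ 3) ^ d * Real.exp (-1 * n / (N ^ 8 * t ^ 2)) := by positivity
  by_cases hNt : N ^ 3 * t < 1
  · have hSu : S = Set.univ := by
      apply Set.eq_univ_of_forall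
      intro x
      apply hred
      intro u _
      calc ∑ i, maj w t N u (x i) ≤ ∑ i : Fin n, (1:ℝ) :=
            Finset.sum_le_sum fun i _ => (maj_le w t N hN0.le ht u (x i)).trans hNt.le
        _ = n := by simp
        _ ≤ 400 * n := by linarith
    rw [hSu, measure_univ, ENNReal.toReal_one]
    linarith
  push Not at hNt
  obtain ⟨T₁, hT₁n, hT₁c, hT₁k⟩ := exists_net d (1 / 4) (by norm_num)
  obtain ⟨T₂, hT₂n, hT₂c, hT₂k⟩ := exists_net d (1 / N ^ 2) (by positivity)
  set B₁ := ⋃ v ∈ T₁, {x : Fin n → Fin d → ℝ | n * ((4:ℝ) + 4) ≤ ∑ i, (dot v.ofLp (x i)) ^ 2}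
    with hB₁
  set B₂ := ⋃ v ∈ T₂, {x : Fin n → Fin d → ℝ | n * ((256:ℝ) + 1) ≤ ∑ i, maj w t N v.ofLp (x i)}
    with hB₂
  have hm1 : sample n d B₁ ≤ ENNReal.ofReal ((1 + 2 / (1 / 4)) ^ d * Real.exp (-(1 / 4 * n * 4))) := by
    apply union_tail _ _ _ _ _ hT₁k
    intro v hv
    refine chernoff_s11 (_root_.stdGaussian d) n (fun y => (dot v.ofLp y) ^ 2) (by fun_prop) (1 / 4) 4 4
      (by norm_num) ?_
    have h1 := dot_exp_lintegral (u := v.ofLp) (by rw [nrm_eq]; exact hT₁n v hv)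
    simp_rw [one_div_mul_eq_div]
    refine h1.trans ?_
    rw [show (2 : ENNReal) = ENNReal.ofReal 2 by simp]
    apply ENNReal.ofReal_le_ofReal
    have := Real.add_one_le_exp ((4:ℝ) / 4)
    linarith
  have hm2 : sample n d B₂ ≤
      ENNReal.ofReal ((1 + 2 / (1 / N ^ 2)) ^ d * Real.exp (-((N ^ 3 * t)⁻¹ * n * 1))) := by
    apply union_tail _ _ _ _ _ hT₂k
    intro v hv
    exact chernoff_s11 (_root_.stdGaussian d) n (maj w t N v.ofLp) (measurable_maj _ _ _ _) _ 256 1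
      (by positivity) (maj_exp_lintegral hw (by rw [nrm_eq]; exact hT₂n v hv) t N hN0 ht)
  have hcov : (Set.univ : Set (Fin n → Fin d → ℝ)) ⊆ S ∪ (B₁ ∪ B₂) := by
    intro x _
    by_cases hx1 : x ∈ B₁
    · exact Or.inr (Or.inl hx1)
    by_cases hx2 : x ∈ B₂
    · exact Or.inr (Or.inr hx2)
    left
    apply hred
    intro u hu
    simp only [hB₁, Set.mem_iUnion, Set.mem_ofPred_eq, not_exists, not_le] at hx1
    simp only [hB₂, Set.mem_iUnion, Set.mem_ofPred_eq, not_exists, not_le] at hx2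
    have hQ := cov_bound x T₁ hT₁c (fun v hv => by linarith [hx1 v hv])
    obtain ⟨v, hv, huv⟩ := hT₂c (WithLp.toLp 2 u) (by rw [← nrm_eq]; exact hu)
    have hQ1 := hQ (WithLp.toLp 2 u - v)
    have hQ2 := hQ (WithLp.toLp 2 w)
    rw [← nrm_eq (WithLp.toLp 2 w)] at hQ2
    simp only [hw, WithLp.ofLp_sub] at hQ1 hQ2
    have hZ := hx2 v hv
    have hsum : ∑ i, maj w t N u (x i) ≤ ∑ i, maj w t N v.ofLp (x i) +
        3 / 2 * (N ^ 4 * ∑ i, (dot (u - v.ofLp) (x i)) ^ 2 + ∑ i, (dot w (x i)) ^ 2) := by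
      rw [Finset.mul_sum, ← Finset.sum_add_distrib, Finset.mul_sum, ← Finset.sum_add_distrib]
      exact Finset.sum_le_sum fun i _ => maj_lip w t N hN0.le ht u v.ofLp (x i)
    have hQ3 : N ^ 4 * ∑ i, (dot (u - v.ofLp) (x i)) ^ 2 ≤ 16 * n := by
      calc _ ≤ N ^ 4 * (16 * n * (1 / N ^ 2) ^ 2) := by
            gcongr
            refine hQ1.trans ?_
            gcongr
        _ = 16 * n := by field_simp
    linarith
  have hone : (1 : ENNReal) ≤ sample n d S + (sample n d B₁ + sample n d B₂) := by
    rw [← measure_univ (μ := sample n d)]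
    refine (measure_mono hcov).trans ((measure_union_le _ _).trans ?_)
    gcongr
    exact measure_union_le _ _
  have hone' : (1 : ℝ) ≤ (sample n d S).toReal + ((sample n d B₁).toReal + (sample n d B₂).toReal) := by
    rw [← ENNReal.toReal_add (measure_ne_top _ _) (measure_ne_top _ _),
      ← ENNReal.toReal_add (measure_ne_top _ _)
        (ENNReal.add_ne_top.2 ⟨measure_ne_top _ _, measure_ne_top _ _⟩), ← ENNReal.toReal_one]
    exact ENNReal.toReal_mono (ENNReal.add_ne_top.2 ⟨measure_ne_top _ _,
      ENNReal.add_ne_top.2 ⟨measure_ne_top _ _, measure_ne_top _ _⟩⟩) hone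
  have hr1 := ENNReal.toReal_le_of_le_ofReal (by positivity) hm1
  have hr2 := ENNReal.toReal_le_of_le_ofReal (by positivity) hm2
  have hf1 : (1 + 2 / (1 / 4) : ℝ) ^ d * Real.exp (-(1 / 4 * n * 4)) ≤
      400 * Real.exp (400 * d - 1 * n) := by
    have h9 : (1 + 2 / (1 / 4) : ℝ) ^ d ≤ Real.exp (400 * d) := by
      rw [mul_comm (400:ℝ), Real.exp_nat_mul]
      gcongr
      linarith [Real.add_one_le_exp (400:ℝ)]
    calc _ ≤ Real.exp (400 * d) * Real.exp (-(1 / 4 * n * 4)) := by gcongr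
      _ = Real.exp (400 * d - 1 * n) := by rw [← Real.exp_add]; congr 1; ring
      _ ≤ _ := by linarith [Real.exp_pos (400 * d - 1 * n)]
  have hf2 : (1 + 2 / (1 / N ^ 2)) ^ d * Real.exp (-((N ^ 3 * t)⁻¹ * n * 1)) ≤
      400 * (1 + 400 * N ^ 3) ^ d * Real.exp (-1 * n / (N ^ 8 * t ^ 2)) := by
    have ha : (1 + 2 / (1 / N ^ 2)) ^ d ≤ (1 + 400 * N ^ 3) ^ d := by
      gcongr
      have : 2 / (1 / N ^ 2) = 2 * N ^ 2 := by field_simp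
      rw [this]
      nlinarith [sq_nonneg N, mul_nonneg (sq_nonneg N) hN0.le]
    have hb : Real.exp (-((N ^ 3 * t)⁻¹ * n * 1)) ≤ Real.exp (-1 * n / (N ^ 8 * t ^ 2)) := by
      apply Real.exp_le_exp.2
      have h8 : N ^ 3 * t ≤ N ^ 8 * t ^ 2 := by
        have e : N ^ 8 * t ^ 2 = (N ^ 3 * t) * (N ^ 2 * (N ^ 3 * t)) := by ring
        rw [e]
        have : 1 ≤ N ^ 2 * (N ^ 3 * t) := one_le_mul_of_one_le_of_one_le (by nlinarith) hNt
        exact le_mul_of_one_le_right (by positivity) this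
      have h7 : (N ^ 8 * t ^ 2)⁻¹ ≤ (N ^ 3 * t)⁻¹ := inv_anti₀ (by positivity) h8
      have h6 := mul_le_mul_of_nonneg_right h7 hn0
      have e : -1 * (n:ℝ) / (N ^ 8 * t ^ 2) = -((N ^ 8 * t ^ 2)⁻¹ * n) := by
        rw [div_eq_mul_inv]; ring
      rw [e]; linarith
    calc _ ≤ (1 + 400 * N ^ 3) ^ d * Real.exp (-1 * n / (N ^ 8 * t ^ 2)) := by gcongr
      _ ≤ _ := by
        have : 0 ≤ (1 + 400 * N ^ 3) ^ d * Real.exp (-1 * n / (N ^ 8 * t ^ 2)) := by positivity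
        rw [mul_assoc]; linarith
  linarith
end
end
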